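/- Let j be a unit of ZMod m with j² = 1, and let β = gcd(j − 1, m), α = gcd(j + 1, m) (computed with integer representatives). Then either α·β = m or α·β = 2m. -/

import Mathlib

/-- If `j² ≡ 1 (mod m)` and `α = gcd(j+1, m)`, `β = gcd(j-1, m)`, then
`α·β = m` or `α·β = 2m`. -/
theorem stmt_13 (m : ℕ) (hm : 0 < m) (j : ℤ)
    (hj : j ^ 2 ≡ 1 [ZMOD (m : ℤ)]) :
    Int.gcd (j + 1) (m : ℤ) * Int.gcd (j - 1) (m : ℤ) = m ∨
    Int.gcd (j + 1) (m : ℤ) * Int.gcd (j - 1) (m : ℤ) = 2 * m := by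
  have hdvd : (m : ℤ) ∣ (j + 1) * (j - 1) := by
    convert hj.symm.dvd using 1
    ring
  have hlower : m ∣ Int.gcd (j + 1) m * Int.gcd (j - 1) m := by
    rw [Int.gcd_comm (j + 1), Int.gcd_comm (j - 1)]
    refine Nat.dvd_gcd_mul_gcd_iff_dvd_mul.mpr ?_
    rw [← Int.natAbs_mul]
    exact Int.natCast_dvd.mp hdvd
  have hupper : Int.gcd (j + 1) m * Int.gcd (j - 1) m ∣ m * 2 := by
    rw [← Int.natCast_dvd_natCast]
    simp only [Nat.cast_mul, Nat.cast_ofNat]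
    have hplus := mul_dvd_mul (Int.gcd_dvd_left (j + 1) m) (Int.gcd_dvd_right (j - 1) m)
    have hminus := mul_dvd_mul (Int.gcd_dvd_right (j + 1) m) (Int.gcd_dvd_left (j - 1) m)
    have hsub : (j + 1) * m - m * (j - 1) = (m : ℤ) * 2 := by ring
    exact hsub ▸ dvd_sub hplus hminus
  obtain ⟨k, hk⟩ := hlower
  rw [hk] at hupper ⊢
  rcases (Nat.dvd_prime Nat.prime_two).mp (Nat.dvd_of_mul_dvd_mul_left hm hupper) with rfl | rfl
  · exact .inl (mul_one m)
  · exact .inr (mul_comm m 2)
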